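/- Let Γ' > 1. There exist constants C > 0 and D' > 1, depending only on Γ' and the dimension n, such that for all locally finite positive Borel measures σ, ω on ℝ^n whose full testing constant is finite, T_M(σ,ω) < ∞, one has the a priori inequality N_M(σ,ω) ≤ C ( T_M^{D'}(Γ')(σ,ω) + √(A₂(σ,ω)) ). -/

import Mathlib

open MeasureTheory Set Filter
open scoped ENNReal NNReal

noncomputable section

/-- An axis-parallel half-open cube in `ℝⁿ`, given by its lower corner and (positive)
side length. -/
structure Cube (n : ℕ) where
  corner : Fin n → ℝ
  side : ℝ
  side_pos : 0 < side

namespace Cube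

variable {n : ℕ}

/-- The underlying (half-open) set of the cube. -/
def toSet (Q : Cube n) : Set (Fin n → ℝ) :=
  {x | ∀ i, Q.corner i ≤ x i ∧ x i < Q.corner i + Q.side}

/-- The concentric dilate `ΓQ` of the cube `Q` (same center, side length `Γ·ℓ(Q)`),
as a set. -/
def dilate (Q : Cube n) (Γ : ℝ) : Set (Fin n → ℝ) :=
  {x | ∀ i, Q.corner i - (Γ - 1) * Q.side / 2 ≤ x i ∧
       x i < Q.corner i + Q.side + (Γ - 1) * Q.side / 2}

/-- Membership in `𝒫ⁿ`: the side length is an integral power of `2`. -/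
def memP (Q : Cube n) : Prop := ∃ ℓ : ℤ, Q.side = (2:ℝ) ^ ℓ

end Cube

/-- The translation applied at scale `2^ℓ` in the random dyadic grid determined by `β`:
`Σ_{j : 2^{-j} < 2^ℓ} 2^{-j} β_j`. -/
def gridShift {n : ℕ} (β : ℤ → Fin n → Bool) (ℓ : ℤ) (i : Fin n) : ℝ :=
  ∑' j : ℤ, if (2:ℝ) ^ (-j) < (2:ℝ) ^ ℓ ∧ β j i = true then (2:ℝ) ^ (-j) else 0

/-- Membership in the shifted dyadic grid `𝒟^β`. -/
def memGrid {n : ℕ} (β : ℤ → Fin n → Bool) (Q : Cube n) : Prop :=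
  ∃ (ℓ : ℤ) (k : Fin n → ℤ), Q.side = (2:ℝ) ^ ℓ ∧
    ∀ i, Q.corner i = (2:ℝ) ^ ℓ * (k i : ℝ) + gridShift β ℓ i

/-- The Hardy–Littlewood maximal function of a measure, over cubes in `𝒫ⁿ`. -/
def maximal {n : ℕ} (μ : Measure (Fin n → ℝ)) (x : Fin n → ℝ) : ℝ≥0∞ :=
  ⨆ (Q : Cube n) (_ : Q.memP) (_ : x ∈ Q.toSet), μ Q.toSet / volume Q.toSet

/-- The dyadic maximal function relative to the grid `𝒟^β`. -/
def dyadicMaximal {n : ℕ} (β : ℤ → Fin n → Bool) (μ : Measure (Fin n → ℝ))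
    (x : Fin n → ℝ) : ℝ≥0∞ :=
  ⨆ (Q : Cube n) (_ : memGrid β Q) (_ : x ∈ Q.toSet), μ Q.toSet / volume Q.toSet

/-- The two-weight Muckenhoupt constant `A₂(σ,ω)`. -/
def A2 {n : ℕ} (σ ω : Measure (Fin n → ℝ)) : ℝ≥0∞ :=
  ⨆ (Q : Cube n) (_ : Q.memP), (σ Q.toSet / volume Q.toSet) * (ω Q.toSet / volume Q.toSet)

/-- The operator norm `𝔑_M(σ,ω)` of the maximal function from `L²(σ)` to `L²(ω)`:
the least `N` with `∫ M(fσ)² dω ≤ N² ∫ f² dσ` for all (nonnegative) `f`. -/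
def opNorm {n : ℕ} (σ ω : Measure (Fin n → ℝ)) : ℝ≥0∞ :=
  sInf {N : ℝ≥0∞ | ∀ f : (Fin n → ℝ) → ℝ≥0∞, Measurable f →
    ∫⁻ x, (maximal (σ.withDensity f) x) ^ 2 ∂ω ≤ N ^ 2 * ∫⁻ x, (f x) ^ 2 ∂σ}

/-- The full testing constant `𝔗_M(σ,ω)`: the least `T` with
`∫_Q M(1_Q σ)² dω ≤ T² σ(Q)` for all `Q ∈ 𝒫ⁿ`. -/
def fullTesting {n : ℕ} (σ ω : Measure (Fin n → ℝ)) : ℝ≥0∞ :=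
  sInf {T : ℝ≥0∞ | ∀ Q : Cube n, Q.memP →
    ∫⁻ x in Q.toSet, (maximal (σ.restrict Q.toSet) x) ^ 2 ∂ω ≤ T ^ 2 * σ Q.toSet}

/-- The restricted (`D`-`Γ`-doubling) testing constant `𝔗_M^D(Γ)(σ,ω)`. -/
def testD {n : ℕ} (D Γ : ℝ) (σ ω : Measure (Fin n → ℝ)) : ℝ≥0∞ :=
  sInf {T : ℝ≥0∞ | ∀ Q : Cube n, Q.memP → σ (Q.dilate Γ) ≤ ENNReal.ofReal D * σ Q.toSet →
    ∫⁻ x in Q.toSet, (maximal (σ.restrict Q.toSet) x) ^ 2 ∂ω ≤ T ^ 2 * σ Q.toSet}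

/-- The `σ`-average of `f` over `A`. -/
def setAvg {X : Type*} [MeasurableSpace X] (σ : Measure X) (f : X → ℝ≥0∞) (A : Set X) : ℝ≥0∞ :=
  (∫⁻ x in A, f x ∂σ) / σ A

section Averages

variable {X : Type*} [MeasurableSpace X] {σ : Measure X} {f : X → ℝ≥0∞}

lemma setAvg_mul_measure {A : Set X} (hA : σ A ≠ ⊤) :
    setAvg σ f A * σ A = ∫⁻ x in A, f x ∂σ := by
  unfold setAvg
  by_cases h : σ A = 0
  · rw [h, setLIntegral_measure_zero _ _ h]; simp
  · exact ENNReal.div_mul_cancel h hA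

lemma setAvg_ne_top {A : Set X} (hf : ∫⁻ x, f x ∂σ ≠ ⊤) : setAvg σ f A ≠ ⊤ := by
  unfold setAvg
  by_cases h : σ A = 0
  · rw [h, setLIntegral_measure_zero _ _ h]; simp
  · exact ENNReal.div_ne_top (ne_top_of_le_ne_top hf (setLIntegral_le_lintegral _ _)) h

variable {ι : Type*} [Countable ι] [MeasurableSpace ι] [DiscreteMeasurableSpace ι] {p : X → ι}

lemma lintegral_eq_tsum_fiber (hp : Measurable p) (μ : Measure X) (g : X → ℝ≥0∞) :
    ∫⁻ x, g x ∂μ = ∑' k, ∫⁻ x in p ⁻¹' {k}, g x ∂μ := by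
  rw [← lintegral_iUnion (fun k => hp (measurableSet_singleton k))
    (fun i j hij => Disjoint.preimage _ (by simpa using hij)), ← setLIntegral_univ]
  congr 2
  ext x; simp

lemma setLIntegral_fiber_comp (hp : Measurable p) (μ : Measure X) (φ : ι → ℝ≥0∞)
    (f : X → ℝ≥0∞) (hf : Measurable f) (k : ι) :
    ∫⁻ x in p ⁻¹' {k}, φ (p x) * f x ∂μ = φ k * ∫⁻ x in p ⁻¹' {k}, f x ∂μ := by
  rw [← lintegral_const_mul _ hf]
  refine setLIntegral_congr_fun (hp (measurableSet_singleton k)) fun x hx => ?_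
  have : p x = k := hx
  simp [this]

lemma lintegral_comp_eq_tsum (hp : Measurable p) (μ : Measure X) (φ : ι → ℝ≥0∞) :
    ∫⁻ x, φ (p x) ∂μ = ∑' k, φ k * μ (p ⁻¹' {k}) := by
  rw [lintegral_eq_tsum_fiber hp]
  refine tsum_congr fun k => ?_
  simpa using setLIntegral_fiber_comp hp μ φ (fun _ => 1) measurable_const k

/-- Averaging over the fibers of `p` is `σ`-symmetric against functions of `p`. -/
lemma lintegral_comp_mul_setAvg (hp : Measurable p) (hfin : ∀ k, σ (p ⁻¹' {k}) ≠ ⊤)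
    (hf : Measurable f) (φ : ι → ℝ≥0∞) :
    ∫⁻ x, φ (p x) * setAvg σ f (p ⁻¹' {p x}) ∂σ = ∫⁻ x, φ (p x) * f x ∂σ := by
  rw [lintegral_comp_eq_tsum hp σ (fun k => φ k * setAvg σ f (p ⁻¹' {k})),
    lintegral_eq_tsum_fiber hp]
  refine tsum_congr fun k => ?_
  rw [setLIntegral_fiber_comp hp σ φ f hf, mul_assoc, setAvg_mul_measure (hfin k)]

lemma two_mul_mul_le_add_sq_ennreal (a b : ℝ≥0∞) : 2 * (a * b) ≤ a ^ 2 + b ^ 2 := by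
  by_cases ha : a = ⊤
  · simp [ha]
  by_cases hb : b = ⊤
  · simp [hb]
  lift a to ℝ≥0 using ha
  lift b to ℝ≥0 using hb
  norm_cast
  rw [← NNReal.coe_le_coe]
  push_cast
  nlinarith [sq_nonneg ((a : ℝ) - b)]

lemma eight_mul_mul_add_sq_le {a b : ℝ≥0∞} (h : 2 * b ≤ a) :
    8 * (b * a) + a ^ 2 ≤ 4 * a ^ 2 + 4 * b ^ 2 := by
  by_cases ha : a = ⊤
  · simp [ha, ENNReal.mul_top]
  have hb : b ≠ ⊤ := by
    rintro rfl
    simp [ENNReal.mul_top] at h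
    exact ha h
  lift a to ℝ≥0 using ha
  lift b to ℝ≥0 using hb
  norm_cast at h ⊢
  rw [← NNReal.coe_le_coe] at h ⊢
  push_cast at h ⊢
  nlinarith [sq_nonneg ((a : ℝ) - b), b.2, a.2]

lemma sq_lintegral_le {μ : Measure X} (hf : Measurable f) (A : Set X) :
    (∫⁻ x in A, f x ∂μ) ^ 2 ≤ μ A * ∫⁻ x in A, f x ^ 2 ∂μ := by
  have := ENNReal.lintegral_mul_le_Lp_mul_Lq (μ.restrict A)
    (Real.HolderConjugate.two_two) (f := f) (g := fun _ => 1) hf.aemeasurable aemeasurable_const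
  simp only [Pi.mul_apply, mul_one, ENNReal.one_rpow, lintegral_const, MeasurableSet.univ,
    Measure.restrict_apply, univ_inter, one_mul] at this
  calc _ ≤ _ := pow_le_pow_left' this 2
    _ = _ := by
      rw [mul_pow, ← ENNReal.rpow_natCast, ← ENNReal.rpow_natCast, ← ENNReal.rpow_mul,
        ← ENNReal.rpow_mul]
      norm_num [mul_comm]

lemma lintegral_setAvg_sq_le (hp : Measurable p) (hfin : ∀ k, σ (p ⁻¹' {k}) ≠ ⊤)
    (hf : Measurable f) :
    ∫⁻ x, setAvg σ f (p ⁻¹' {p x}) ^ 2 ∂σ ≤ ∫⁻ x, f x ^ 2 ∂σ := by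
  rw [lintegral_comp_eq_tsum hp σ (fun k => setAvg σ f (p ⁻¹' {k}) ^ 2),
    lintegral_eq_tsum_fiber hp]
  refine ENNReal.tsum_le_tsum fun k => ?_
  have h := sq_lintegral_le (μ := σ) hf (p ⁻¹' {k})
  by_cases h0 : σ (p ⁻¹' {k}) = 0
  · simp [h0]
  rw [← setAvg_mul_measure (hfin k), mul_pow, sq (σ _), ← mul_assoc, mul_comm (σ _)] at h
  exact (ENNReal.mul_le_mul_iff_left h0 (hfin k)).1 h

/-- The energy of the averages of `f` that at least double in passing from a fiber of `π ∘ p`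
to a fiber of `p` is controlled by the increment of the total energy. -/
lemma lintegral_jump_sq_add_le (hp : Measurable p) (hfin : ∀ k, σ (p ⁻¹' {k}) ≠ ⊤)
    {q : X → ι} (hq : Measurable q) (hfinq : ∀ k, σ (q ⁻¹' {k}) ≠ ⊤) (π : ι → ι)
    (hπ : ∀ x, q x = π (p x)) (hf : Measurable f) (hf2 : ∫⁻ x, f x ^ 2 ∂σ ≠ ⊤) (J : Set ι)
    (hJ : ∀ k ∈ J, 2 * setAvg σ f (q ⁻¹' {π k}) ≤ setAvg σ f (p ⁻¹' {k})) :
    ∫⁻ x, (p ⁻¹' J).indicator (fun x => setAvg σ f (p ⁻¹' {p x}) ^ 2) x ∂σ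
      + 4 * ∫⁻ x, setAvg σ f (q ⁻¹' {q x}) ^ 2 ∂σ
      ≤ 4 * ∫⁻ x, setAvg σ f (p ⁻¹' {p x}) ^ 2 ∂σ := by
  set g : ι → ℝ≥0∞ := fun k => setAvg σ f (p ⁻¹' {k}) with hg
  set h : ι → ℝ≥0∞ := fun k => setAvg σ f (q ⁻¹' {k}) with hh
  have mg : Measurable fun x => g (p x) := (measurable_of_countable g).comp hp
  have mh : Measurable fun x => h (q x) := (measurable_of_countable h).comp hq
  have e1 : ∫⁻ x, h (q x) * g (p x) ∂σ = ∫⁻ x, h (q x) ^ 2 ∂σ := by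
    have a := lintegral_comp_mul_setAvg hp hfin hf (fun k => h (π k))
    have b := lintegral_comp_mul_setAvg hq hfinq hf h
    simp only [← hπ] at a
    rw [a, ← b]
    simp only [sq, hh]
  have fin : 4 * ∫⁻ x, h (q x) ^ 2 ∂σ ≠ ⊤ :=
    ENNReal.mul_ne_top (by simp) (ne_top_of_le_ne_top hf2 (lintegral_setAvg_sq_le hq hfinq hf))
  have key : ∫⁻ x, (8 * (h (q x) * g (p x)) + (p ⁻¹' J).indicator (fun x => g (p x) ^ 2) x) ∂σ
      ≤ ∫⁻ x, (4 * g (p x) ^ 2 + 4 * h (q x) ^ 2) ∂σ := by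
    refine lintegral_mono fun x => ?_
    by_cases hx : x ∈ p ⁻¹' J
    · simp only [indicator_of_mem hx]
      refine eight_mul_mul_add_sq_le ?_
      rw [hπ]; exact hJ _ hx
    · simp only [indicator_of_notMem hx, add_zero]
      have := two_mul_mul_le_add_sq_ennreal (g (p x)) (h (q x))
      calc 8 * (h (q x) * g (p x)) = 4 * (2 * (g (p x) * h (q x))) := by ring
        _ ≤ 4 * (g (p x) ^ 2 + h (q x) ^ 2) := by gcongr
        _ = _ := by ring
  rw [lintegral_add_left (by fun_prop), lintegral_const_mul _ (by fun_prop), e1,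
    lintegral_add_left (by fun_prop), lintegral_const_mul _ (by fun_prop),
    lintegral_const_mul _ (by fun_prop)] at key
  refine (ENNReal.add_le_add_iff_right fin).1 (le_trans (le_of_eq ?_) key)
  ring

/-- Square function estimate for the doubling averages along a filtration of partitions. -/
lemma tsum_lintegral_jump_sq_le {p : ℤ → X → ι} (hp : ∀ l, Measurable (p l))
    (hfin : ∀ l k, σ (p l ⁻¹' {k}) ≠ ⊤) (π : ι → ι) (hπ : ∀ l x, p (l + 1) x = π (p l x))
    (hf : Measurable f) (J : ℤ → Set ι)
    (hJ : ∀ l, ∀ k ∈ J l,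
      2 * setAvg σ f (p (l + 1) ⁻¹' {π k}) ≤ setAvg σ f (p l ⁻¹' {k})) :
    ∑' l, ∫⁻ x, (p l ⁻¹' J l).indicator (fun x => setAvg σ f (p l ⁻¹' {p l x}) ^ 2) x ∂σ
      ≤ 4 * ∫⁻ x, f x ^ 2 ∂σ := by
  by_cases hf2 : ∫⁻ x, f x ^ 2 ∂σ = ⊤
  · simp [hf2]
  set a : ℤ → ℝ≥0∞ := fun l =>
    ∫⁻ x, (p l ⁻¹' J l).indicator (fun x => setAvg σ f (p l ⁻¹' {p l x}) ^ 2) x ∂σ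
  set S : ℤ → ℝ≥0∞ := fun l => 4 * ∫⁻ x, setAvg σ f (p l ⁻¹' {p l x}) ^ 2 ∂σ
  have step : ∀ l, a l + S (l + 1) ≤ S l := fun l =>
    lintegral_jump_sq_add_le (hp l) (hfin l) (hp (l + 1)) (hfin (l + 1)) π (hπ l) hf hf2 (J l)
      (hJ l)
  have S_le : ∀ l, S l ≤ 4 * ∫⁻ x, f x ^ 2 ∂σ := fun l => by
    have := lintegral_setAvg_sq_le (hp l) (hfin l) hf
    simp only [S]; gcongr
  have partial_sum : ∀ (l : ℤ) (N : ℕ), ∑ j ∈ Finset.range N, a (l + j) + S (l + N) ≤ S l := by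
    intro l N
    induction N with
    | zero => simp
    | succ N ih =>
      rw [Finset.sum_range_succ, add_assoc]
      refine le_trans (add_le_add le_rfl ?_) ih
      have := step (l + N)
      push_cast
      rwa [← add_assoc]
  rw [ENNReal.tsum_eq_iSup_sum]
  refine iSup_le fun s => ?_
  obtain ⟨b, hb⟩ : ∃ b : ℕ, ∀ l ∈ s, -(b : ℤ) ≤ l ∧ l < b := by
    refine ⟨s.sup (fun l => l.natAbs + 1), fun l hl => ?_⟩
    have := Finset.le_sup (f := fun l : ℤ => l.natAbs + 1) hl
    omega
  calc ∑ l ∈ s, a l ≤ ∑ l ∈ (Finset.range (2 * b)).image (fun j : ℕ => -(b : ℤ) + j), a l := by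
        refine Finset.sum_le_sum_of_subset fun l hl => ?_
        simp only [Finset.mem_image, Finset.mem_range]
        have := hb l hl
        exact ⟨(l + b).toNat, by omega, by omega⟩
    _ = ∑ j ∈ Finset.range (2 * b), a (-(b : ℤ) + j) :=
        Finset.sum_image fun i _ j _ h => by simpa using h
    _ ≤ _ := le_trans (le_trans le_self_add (partial_sum _ _)) (S_le _)

end Averages

section Carleson

variable {X : Type*} [MeasurableSpace X] {σ ω : Measure X} {f : X → ℝ≥0∞} {κ : Type*}

lemma measure_mul_le_of_lt_setAvg (hf : Measurable f) {A : Set X} (hA : σ A ≠ ⊤)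
    {c : ℝ≥0∞} (hc : c ≠ ⊤) (h : c < setAvg σ f A) :
    c * σ A ≤ 2 * ∫⁻ x in A, {x | c < 2 * f x}.indicator f x ∂σ := by
  have hcA : c * σ A ≠ ⊤ := ENNReal.mul_ne_top hc hA
  have h1 : 2 * (c * σ A) ≤ ∫⁻ x in A, 2 * f x ∂σ := by
    rw [lintegral_const_mul _ hf, ← setAvg_mul_measure hA]
    gcongr
  have h2 : ∫⁻ x in A, 2 * f x ∂σ
      ≤ ∫⁻ x in A, (2 * {x | c < 2 * f x}.indicator f x + c) ∂σ := by
    refine lintegral_mono fun x => ?_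
    by_cases hx : c < 2 * f x
    · simp [indicator, hx]
    · simp only [indicator, mem_ofPred_eq, hx, if_false, mul_zero, zero_add]
      exact not_lt.1 hx
  have hm : Measurable ({x | c < 2 * f x}.indicator f) :=
    hf.indicator (measurableSet_lt measurable_const (by fun_prop))
  rw [lintegral_add_right _ measurable_const, lintegral_const_mul _ hm, setLIntegral_const] at h2
  have h3 := h1.trans h2
  rw [two_mul] at h3
  exact (ENNReal.add_le_add_iff_right hcA).1 h3

variable {A : κ → Set X} {s : κ → ℝ≥0∞} {K : ℝ≥0∞}

/-- Weak form of the Carleson embedding theorem at one height `c`. -/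
lemma mul_lintegral_iSup_le (hA : ∀ q, MeasurableSet (A q)) (hfin : ∀ q, σ (A q) ≠ ⊤)
    (hnest : ∀ q r, A q ⊆ A r ∨ A r ⊆ A q ∨ Disjoint (A q) (A r))
    (htest : ∀ r, ∫⁻ x in A r, (⨆ (q) (_ : A q ⊆ A r), (A q).indicator (fun _ => s q ^ 2) x) ∂ω
      ≤ K * σ (A r))
    (hf : Measurable f) (G : Finset κ) {c : ℝ≥0∞} (hc : c ≠ ⊤) :
    c * ∫⁻ x, (⨆ q ∈ G, ⨆ (_ : c < setAvg σ f (A q)), (A q).indicator (fun _ => s q ^ 2) x) ∂ω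
      ≤ 2 * K * ∫⁻ x, {x | c < 2 * f x}.indicator f x ∂σ := by
  classical
  set Gc := G.filter fun q => c < setAvg σ f (A q)
  set F := Gc.image A
  set 𝓜 := F.filter fun I => Maximal (· ∈ F) I
  have mem_F : ∀ I ∈ 𝓜, ∃ r, c < setAvg σ f (A r) ∧ A r = I := by
    intro I hI
    obtain ⟨r, hr, rfl⟩ := Finset.mem_image.1 (Finset.mem_filter.1 hI).1
    exact ⟨r, (Finset.mem_filter.1 hr).2, rfl⟩
  have disj : (𝓜 : Set (Set X)).PairwiseDisjoint id := by
    intro I hI I' hI' hne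
    obtain ⟨r, -, rfl⟩ := mem_F I hI
    obtain ⟨r', -, rfl⟩ := mem_F I' hI'
    have m := (Finset.mem_filter.1 hI).2
    have m' := (Finset.mem_filter.1 hI').2
    rcases hnest r r' with h | h | h
    · exact absurd (m.eq_of_subset m'.1 h) hne
    · exact absurd (m'.eq_of_subset m.1 h) hne.symm
    · exact h
  have meas : ∀ I ∈ 𝓜, MeasurableSet (id I) := by
    intro I hI
    obtain ⟨r, -, rfl⟩ := mem_F I hI
    exact hA r
  set g : X → ℝ≥0∞ := fun x =>
    ⨆ q ∈ G, ⨆ (_ : c < setAvg σ f (A q)), (A q).indicator (fun _ => s q ^ 2) x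
  have cover : ∀ q ∈ G, c < setAvg σ f (A q) → ∃ I ∈ 𝓜, A q ⊆ I := by
    intro q hq hcq
    have : A q ∈ F := Finset.mem_image_of_mem _ (Finset.mem_filter.2 ⟨hq, hcq⟩)
    obtain ⟨I, hI, hmax⟩ := F.exists_le_maximal this
    exact ⟨I, Finset.mem_filter.2 ⟨hmax.1, hmax⟩, hI⟩
  have hg0 : ∀ x, x ∉ ⋃ I ∈ 𝓜, id I → g x = 0 := by
    intro x hx
    simp only [g, ENNReal.iSup_eq_zero]
    intro q hq hcq
    refine indicator_of_notMem (fun hxq => hx ?_) _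
    obtain ⟨I, hI, hqI⟩ := cover q hq hcq
    exact mem_biUnion (show I ∈ (𝓜 : Set _) from hI) (hqI hxq)
  have hgI : ∀ I ∈ 𝓜, ∫⁻ x in id I, g x ∂ω ≤ K * σ I := by
    intro I hI
    obtain ⟨r, hr, rfl⟩ := mem_F I hI
    refine le_trans (setLIntegral_mono' (hA r) fun x hx => ?_) (htest r)
    refine iSup₂_le fun q hq => iSup_le fun hcq => ?_
    by_cases hxq : x ∈ A q
    · have hqr : A q ⊆ A r := by
        obtain ⟨I', hI', hqI⟩ := cover q hq hcq
        have : A r = I' := by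
          by_contra hne
          exact Set.disjoint_left.1 (disj hI hI' hne) hx (hqI hxq)
        rw [this]; exact hqI
      exact le_iSup₂_of_le q hqr le_rfl
    · simp [hxq]
  calc c * ∫⁻ x, g x ∂ω = c * ∫⁻ x in ⋃ I ∈ 𝓜, id I, g x ∂ω := by
        rw [← lintegral_indicator (Finset.measurableSet_biUnion _ meas)]
        congr 2
        ext x
        by_cases hx : x ∈ ⋃ I ∈ 𝓜, id I
        · rw [indicator_of_mem hx]
        · rw [indicator_of_notMem hx, hg0 x hx]
    _ = c * ∑ I ∈ 𝓜, ∫⁻ x in id I, g x ∂ω := by rw [lintegral_biUnion_finset disj meas]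
    _ ≤ c * ∑ I ∈ 𝓜, K * σ I := by gcongr with I hI; exact hgI I hI
    _ = K * ∑ I ∈ 𝓜, c * σ I := by
        rw [← Finset.mul_sum, ← Finset.mul_sum]; ring
    _ ≤ K * ∑ I ∈ 𝓜, 2 * ∫⁻ x in id I, {x | c < 2 * f x}.indicator f x ∂σ := by
        gcongr K * ?_
        refine Finset.sum_le_sum fun I hI => ?_
        obtain ⟨r, hr, rfl⟩ := mem_F I hI
        exact measure_mul_le_of_lt_setAvg hf (hfin r) hc hr
    _ = 2 * K * ∫⁻ x in ⋃ I ∈ 𝓜, id I, {x | c < 2 * f x}.indicator f x ∂σ := by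
        rw [lintegral_biUnion_finset disj meas, ← Finset.mul_sum]; ring
    _ ≤ _ := mul_le_mul_right (setLIntegral_le_lintegral _ _) _

lemma sq_le_lintegral_Ioi {e : ℝ≥0∞} (he : e ≠ ⊤) :
    e ^ 2 ≤ 4 * ∫⁻ t in Ioi (0 : ℝ),
      {t : ℝ | ENNReal.ofReal t < e}.indicator (fun t => ENNReal.ofReal t) t := by
  lift e to ℝ≥0 using he
  have hsub : Ioo ((e : ℝ) / 2) e ⊆ Ioi 0 := fun t ht => lt_of_le_of_lt (by positivity) ht.1
  calc (e : ℝ≥0∞) ^ 2 = 4 * ∫⁻ _ in Ioo ((e : ℝ) / 2) e, ENNReal.ofReal ((e : ℝ) / 2) := by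
        rw [setLIntegral_const, Real.volume_Ioo,
          show (4 : ℝ≥0∞) = ENNReal.ofReal 4 by norm_num,
          ← ENNReal.ofReal_mul (by positivity), ← ENNReal.ofReal_mul (by positivity),
          ← ENNReal.ofReal_coe_nnreal, ← ENNReal.ofReal_pow (NNReal.coe_nonneg e)]
        congr 1; ring
    _ ≤ 4 * ∫⁻ t in Ioo ((e : ℝ) / 2) e,
        {t : ℝ | ENNReal.ofReal t < e}.indicator (fun t => ENNReal.ofReal t) t := by
        gcongr 4 * ?_
        refine setLIntegral_mono' measurableSet_Ioo fun t ht => ?_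
        have : t ∈ {t : ℝ | ENNReal.ofReal t < e} := by
          have h0 : (0 : ℝ) < e := lt_of_le_of_lt (hsub ht).le ht.2
          rw [mem_ofPred_eq, ← ENNReal.ofReal_coe_nnreal]
          exact (ENNReal.ofReal_lt_ofReal_iff h0).2 ht.2
        rw [indicator_of_mem this]
        exact ENNReal.ofReal_le_ofReal ht.1.le
    _ ≤ _ := by gcongr 4 * ?_; exact lintegral_mono_set hsub

lemma lintegral_Ioi_indicator_le (a : ℝ≥0∞) :
    ∫⁻ t in Ioi (0 : ℝ), {t : ℝ | ENNReal.ofReal t < 2 * a}.indicator (fun _ => a) t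
      ≤ 2 * a ^ 2 := by
  by_cases ha : a = ⊤
  · simp [ha]
  lift a to ℝ≥0 using ha
  have hm : MeasurableSet {t : ℝ | ENNReal.ofReal t < 2 * a} :=
    measurableSet_lt (by fun_prop) measurable_const
  rw [lintegral_indicator hm, Measure.restrict_restrict hm, setLIntegral_const]
  have : {t : ℝ | ENNReal.ofReal t < 2 * a} ∩ Ioi 0 ⊆ Ioo 0 (2 * a) := by
    rintro t ⟨ht, h0⟩
    refine ⟨h0, ?_⟩
    have : ENNReal.ofReal t < ENNReal.ofReal (2 * a) := by
      rw [ENNReal.ofReal_mul (by norm_num)]; simpa using ht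
    exact (ENNReal.ofReal_lt_ofReal_iff_of_nonneg (le_of_lt h0)).1 this
  calc _ ≤ (a : ℝ≥0∞) * volume (Ioo (0 : ℝ) (2 * a)) := by gcongr
    _ = _ := by
      rw [Real.volume_Ioo, sub_zero, ENNReal.ofReal_mul (by norm_num)]
      simp; ring

variable [SFinite σ] [SFinite ω]

lemma lintegral_finset_iSup_setAvg_sq_le (hA : ∀ q, MeasurableSet (A q))
    (hfin : ∀ q, σ (A q) ≠ ⊤)
    (hnest : ∀ q r, A q ⊆ A r ∨ A r ⊆ A q ∨ Disjoint (A q) (A r))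
    (htest : ∀ r, ∫⁻ x in A r, (⨆ (q) (_ : A q ⊆ A r), (A q).indicator (fun _ => s q ^ 2) x) ∂ω
      ≤ K * σ (A r))
    (hf : Measurable f) (hf1 : ∫⁻ x, f x ∂σ ≠ ⊤) (G : Finset κ) :
    ∫⁻ x, (⨆ q ∈ G, (A q).indicator (fun _ => (s q * setAvg σ f (A q)) ^ 2) x) ∂ω
      ≤ 16 * K * ∫⁻ x, f x ^ 2 ∂σ := by
  set g : ℝ → X → ℝ≥0∞ := fun t x => ⨆ q ∈ G, ⨆ (_ : ENNReal.ofReal t < setAvg σ f (A q)),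
    (A q).indicator (fun _ => s q ^ 2) x
  have g_eq : g = fun t x => ⨆ q ∈ G,
      {t : ℝ | ENNReal.ofReal t < setAvg σ f (A q)}.indicator 1 t *
        (A q).indicator (fun _ => s q ^ 2) x := by
    ext t x
    refine iSup_congr fun q => iSup_congr fun _ => ?_
    by_cases h : ENNReal.ofReal t < setAvg σ f (A q) <;> simp [h]
  have hgm : Measurable (Function.uncurry g) := by
    rw [g_eq]
    refine Measurable.biSup (G : Set κ) G.countable_toSet fun q _ => ?_
    refine Measurable.mul ?_ ?_
    · exact (measurable_one.indicator
        (measurableSet_lt (by fun_prop) measurable_const)).comp measurable_fst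
    · exact (measurable_const.indicator (hA q)).comp measurable_snd
  have pointwise : ∀ x, (⨆ q ∈ G, (A q).indicator (fun _ => (s q * setAvg σ f (A q)) ^ 2) x)
      ≤ 4 * ∫⁻ t in Ioi (0 : ℝ), ENNReal.ofReal t * g t x := by
    intro x
    refine iSup₂_le fun q hq => ?_
    by_cases hx : x ∈ A q
    · rw [indicator_of_mem hx, mul_pow]
      calc s q ^ 2 * setAvg σ f (A q) ^ 2
          ≤ s q ^ 2 * (4 * ∫⁻ t in Ioi (0 : ℝ), {t : ℝ | ENNReal.ofReal t
              < setAvg σ f (A q)}.indicator (fun t => ENNReal.ofReal t) t) := by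
            gcongr; exact sq_le_lintegral_Ioi (setAvg_ne_top hf1)
        _ = 4 * ∫⁻ t in Ioi (0 : ℝ), s q ^ 2 * {t : ℝ | ENNReal.ofReal t
              < setAvg σ f (A q)}.indicator (fun t => ENNReal.ofReal t) t := by
            rw [lintegral_const_mul _ (ENNReal.measurable_ofReal.indicator
              (measurableSet_lt (by fun_prop) measurable_const))]
            ring
        _ ≤ _ := by
            gcongr 4 * ?_
            refine lintegral_mono fun t => ?_
            by_cases ht : ENNReal.ofReal t < setAvg σ f (A q)
            · simp only [indicator, mem_ofPred_eq, ht, if_true]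
              rw [mul_comm]
              gcongr
              refine le_iSup₂_of_le q hq (le_iSup_of_le ht ?_)
              simp [hx]
            · simp [ht]
    · simp [hx]
  have weak : ∀ t : ℝ, ENNReal.ofReal t * ∫⁻ x, g t x ∂ω
      ≤ 2 * K * ∫⁻ x, {x | ENNReal.ofReal t < 2 * f x}.indicator f x ∂σ := fun t =>
    mul_lintegral_iSup_le hA hfin hnest htest hf G ENNReal.ofReal_ne_top
  clear_value g
  have hgt : ∀ t, Measurable (g t) := fun t => hgm.comp measurable_prodMk_left
  have hgs : Measurable fun z : X × ℝ => ENNReal.ofReal z.2 * g z.2 z.1 :=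
    Measurable.mul (by fun_prop) (hgm.comp measurable_swap)
  calc _ ≤ ∫⁻ x, 4 * (∫⁻ t in Ioi (0 : ℝ), ENNReal.ofReal t * g t x) ∂ω :=
        lintegral_mono pointwise
    _ = 4 * ∫⁻ t in Ioi (0 : ℝ), ENNReal.ofReal t * ∫⁻ x, g t x ∂ω := by
        rw [lintegral_const_mul]
        · rw [lintegral_lintegral_swap]
          · congr 2
            ext t
            exact lintegral_const_mul _ (hgt t)
          · exact hgs.aemeasurable
        · exact Measurable.lintegral_prod_right' hgs
    _ ≤ 4 * ∫⁻ t in Ioi (0 : ℝ), 2 * K *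
          ∫⁻ x, {x | ENNReal.ofReal t < 2 * f x}.indicator f x ∂σ := by
        gcongr 4 * ?_
        exact lintegral_mono weak
    _ = 8 * K * ∫⁻ x, (∫⁻ t in Ioi (0 : ℝ),
          {t : ℝ | ENNReal.ofReal t < 2 * f x}.indicator (fun _ => f x) t) ∂σ := by
        have hm : Measurable (fun z : ℝ × X =>
            {z : ℝ × X | ENNReal.ofReal z.1 < 2 * f z.2}.indicator (fun z => f z.2) z) :=
          (hf.comp measurable_snd).indicator (measurableSet_lt (by fun_prop) (by fun_prop))
        rw [lintegral_const_mul]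
        · rw [lintegral_lintegral_swap]
          · rw [← mul_assoc, ← mul_assoc]
            norm_num
            rfl
          · exact hm.aemeasurable
        · exact Measurable.lintegral_prod_right' hm
    _ ≤ 8 * K * ∫⁻ x, 2 * f x ^ 2 ∂σ := by
        gcongr with x; exact lintegral_Ioi_indicator_le (f x)
    _ = _ := by rw [lintegral_const_mul _ (by fun_prop)]; ring

/-- Carleson embedding for a nested family: a testing condition on every member of the family
controls the maximal function built from the family. -/
lemma lintegral_iSup_setAvg_sq_le [Countable κ] (hA : ∀ q, MeasurableSet (A q))
    (hfin : ∀ q, σ (A q) ≠ ⊤)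
    (hnest : ∀ q r, A q ⊆ A r ∨ A r ⊆ A q ∨ Disjoint (A q) (A r))
    (htest : ∀ r, ∫⁻ x in A r, (⨆ (q) (_ : A q ⊆ A r), (A q).indicator (fun _ => s q ^ 2) x) ∂ω
      ≤ K * σ (A r))
    (hf : Measurable f) (hf1 : ∫⁻ x, f x ∂σ ≠ ⊤) :
    ∫⁻ x, (⨆ q, (A q).indicator (fun _ => (s q * setAvg σ f (A q)) ^ 2) x) ∂ω
      ≤ 16 * K * ∫⁻ x, f x ^ 2 ∂σ := by
  simp_rw [iSup_eq_iSup_finset (fun q => (A q).indicator (fun _ => (s q * setAvg σ f (A q)) ^ 2) _)]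
  rw [lintegral_iSup_directed_of_measurable]
  · exact iSup_le fun G => lintegral_finset_iSup_setAvg_sq_le hA hfin hnest htest hf hf1 G
  · exact fun G => Measurable.biSup (G : Set κ) G.countable_toSet
      fun q _ => measurable_const.indicator (hA q)
  · refine Monotone.directed_le fun G G' h x => ?_
    exact biSup_mono fun q hq => h hq

end Carleson

section Grid

variable {n : ℕ}

lemma Cube.toSet_eq_pi (Q : Cube n) :
    Q.toSet = Set.pi univ fun i => Ico (Q.corner i) (Q.corner i + Q.side) := by
  ext x; simp [Cube.toSet]

lemma Cube.measurableSet_toSet (Q : Cube n) : MeasurableSet Q.toSet := by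
  rw [Q.toSet_eq_pi]
  exact MeasurableSet.univ_pi fun i => measurableSet_Ico

lemma Cube.volume_toSet (Q : Cube n) : volume Q.toSet = ENNReal.ofReal Q.side ^ n := by
  rw [Q.toSet_eq_pi, Real.volume_pi_Ico]; simp

lemma Cube.volume_ne_zero (Q : Cube n) : volume Q.toSet ≠ 0 := by
  rw [Q.volume_toSet]
  exact pow_ne_zero _ (by simpa using Q.side_pos)

lemma Cube.volume_ne_top (Q : Cube n) : volume Q.toSet ≠ ⊤ := by
  rw [Q.volume_toSet]
  exact ENNReal.pow_ne_top ENNReal.ofReal_ne_top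

lemma Cube.measure_ne_top (Q : Cube n) (σ : Measure (Fin n → ℝ)) [IsLocallyFiniteMeasure σ] :
    σ Q.toSet ≠ ⊤ := by
  have : Q.toSet ⊆ Icc Q.corner (fun i => Q.corner i + Q.side) :=
    fun x hx => ⟨fun i => (hx i).1, fun i => (hx i).2.le⟩
  exact ((measure_mono this).trans_lt isCompact_Icc.measure_lt_top).ne

/-- The cube of index `k` and side length `(4 ^ m) ^ l` in the grid translated by `t / 3` times
the side length. Since `4 ^ m ≡ 1 [MOD 3]`, these grids are nested as `l` varies. -/
def cell (m : ℕ) (t : Fin n → Fin 3) (l : ℤ) (k : Fin n → ℤ) : Cube n where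
  corner i := ((4 : ℝ) ^ m) ^ l * (k i + (t i : ℕ) / 3)
  side := ((4 : ℝ) ^ m) ^ l
  side_pos := by positivity

/-- The index of the cell of generation `l` that contains `x`. -/
def cellIndex (m : ℕ) (t : Fin n → Fin 3) (l : ℤ) (x : Fin n → ℝ) (i : Fin n) : ℤ :=
  ⌊x i / ((4 : ℝ) ^ m) ^ l - (t i : ℕ) / 3⌋

/-- The index of the cell of the next generation that contains the cell of index `k`. -/
def parentIndex (m : ℕ) (t : Fin n → Fin 3) (k : Fin n → ℤ) (i : Fin n) : ℤ :=
  (k i - (t i : ℕ) * ((4 ^ m - 1) / 3)) / (4 ^ m : ℕ)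

variable {m : ℕ} {t : Fin n → Fin 3} {l : ℤ} {k : Fin n → ℤ}

lemma mem_cell {x : Fin n → ℝ} : x ∈ (cell m t l k).toSet ↔ cellIndex m t l x = k := by
  have hL : (0 : ℝ) < ((4 : ℝ) ^ m) ^ l := by positivity
  rw [funext_iff]
  refine forall_congr' fun i => ?_
  simp only [cell, cellIndex, Int.floor_eq_iff]
  rw [le_sub_iff_add_le, le_div_iff₀ hL, sub_lt_iff_lt_add, div_lt_iff₀ hL]
  constructor <;> rintro ⟨h1, h2⟩ <;> constructor <;> linarith

lemma cell_toSet_eq_preimage : (cell m t l k).toSet = cellIndex m t l ⁻¹' {k} := by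
  ext x; exact mem_cell

lemma measurable_cellIndex : Measurable (cellIndex m t l) := by
  unfold cellIndex
  fun_prop

lemma memP_cell : (cell m t l k).memP :=
  ⟨2 * m * l, by
    simp only [cell]
    rw [zpow_mul, show ((2 : ℝ) ^ (2 * (m : ℤ))) = 4 ^ m by rw [zpow_mul]; norm_num]⟩

lemma cellIndex_succ (x : Fin n → ℝ) :
    cellIndex m t (l + 1) x = parentIndex m t (cellIndex m t l x) := by
  ext i
  have hc : (3 : ℤ) * ((4 ^ m - 1) / 3) = 4 ^ m - 1 :=
    Int.mul_ediv_cancel' (by simpa using sub_dvd_pow_sub_pow (4 : ℤ) 1 m)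
  have hc' : (3 : ℝ) * (((4 ^ m - 1) / 3 : ℤ) : ℝ) = 4 ^ m - 1 := by exact_mod_cast hc
  simp only [cellIndex, parentIndex]
  rw [← Int.floor_sub_intCast, ← Int.floor_div_natCast]
  congr 1
  have hb : (4 : ℝ) ^ m ≠ 0 := by positivity
  have hL : ((4 : ℝ) ^ m) ^ l ≠ 0 := by positivity
  rw [zpow_add_one₀ hb]
  set c : ℤ := (4 ^ m - 1) / 3
  push_cast
  field_simp
  linear_combination (((4 : ℝ) ^ m) ^ l * (t i : ℕ)) * hc'

lemma volume_cell_succ (k' : Fin n → ℤ) (t' : Fin n → Fin 3) :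
    volume (cell m t' (l + 1) k').toSet
      = ENNReal.ofReal (4 ^ m) ^ n * volume (cell m t l k).toSet := by
  rw [Cube.volume_toSet, Cube.volume_toSet, ← mul_pow]
  simp only [cell]
  rw [← ENNReal.ofReal_mul (by positivity), zpow_add_one₀ (by positivity), mul_comm]

lemma cell_nested_of_le {l' : ℤ} {k' : Fin n → ℤ} (h : l ≤ l') :
    (cell m t l k).toSet ⊆ (cell m t l' k').toSet ∨
      Disjoint (cell m t l k).toSet (cell m t l' k').toSet := by
  have aux : ∀ (N : ℕ) (x y : Fin n → ℝ), cellIndex m t l x = cellIndex m t l y →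
      cellIndex m t (l + N) x = cellIndex m t (l + N) y := by
    intro N x y hxy
    induction N with
    | zero => simpa using hxy
    | succ N ih =>
      push_cast
      rw [← add_assoc, cellIndex_succ, cellIndex_succ, ih]
  obtain ⟨N, rfl⟩ := Int.le.dest h
  by_contra! hcon
  obtain ⟨h1, h2⟩ := hcon
  obtain ⟨x, hx, hx'⟩ := Set.not_disjoint_iff.1 h2
  rw [mem_cell] at hx hx'
  refine h1 fun y hy => ?_
  rw [mem_cell] at hy ⊢
  rw [← hx']
  exact aux N y x (hy.trans hx.symm)

lemma cell_nested {l' : ℤ} {k' : Fin n → ℤ} :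
    (cell m t l k).toSet ⊆ (cell m t l' k').toSet ∨
      (cell m t l' k').toSet ⊆ (cell m t l k).toSet ∨
      Disjoint (cell m t l k).toSet (cell m t l' k').toSet := by
  rcases le_total l l' with h | h
  · rcases cell_nested_of_le (m := m) (t := t) (k := k) (k' := k') h with h | h <;> tauto
  · rcases cell_nested_of_le (m := m) (t := t) (k := k') (k' := k) h with h | h
    · tauto
    · exact Or.inr (Or.inr h.symm)

lemma floor_sub_third_eq {a b y : ℝ} (hab : b - a < 1 / 3) {r : ℕ}
    (hr : (r : ℤ) % 3 ≠ ⌊3 * b⌋ % 3) (hy : y ∈ Icc a b) :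
    ⌊y - r / 3⌋ = ⌊a - r / 3⌋ := by
  by_contra hne
  have hlt : ⌊a - r / 3⌋ < ⌊y - r / 3⌋ :=
    lt_of_le_of_ne (Int.floor_le_floor (by linarith [hy.1])) (Ne.symm hne)
  have h1 := Int.floor_lt.1 hlt
  have h2 := Int.floor_le (y - (r : ℝ) / 3)
  have : ⌊3 * b⌋ = 3 * ⌊y - r / 3⌋ + r := by
    rw [Int.floor_eq_iff]
    push_cast
    constructor <;> linarith [hy.2]
  omega

lemma exists_fin_three_ne (a b : ℤ) :
    ∃ r : Fin 3, ((r : ℕ) : ℤ) % 3 ≠ a % 3 ∧ ((r : ℕ) : ℤ) % 3 ≠ b % 3 := by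
  have : ∃ r : ℕ, r < 3 ∧ (r : ℤ) % 3 ≠ a % 3 ∧ (r : ℤ) % 3 ≠ b % 3 := by
    by_contra! h
    have h0 := h 0
    have h1 := h 1
    have h2 := h 2
    omega
  obtain ⟨r, hr, h⟩ := this
  exact ⟨⟨r, hr⟩, h⟩

/-- One-third trick at two consecutive generations: every cube is contained in a cell of
comparable size of one of the `3 ^ n` grids, whose `Γ`-dilate is contained in its parent. -/
lemma exists_cell_dilate_subset {Γ : ℝ} (hΓ : 1 < Γ) (hm : 6 * Γ + 9 < 4 ^ m) (Q : Cube n)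
    (hQ : 6 * Q.side ≤ ((4 : ℝ) ^ m) ^ l) :
    ∃ (t : Fin n → Fin 3) (k : Fin n → ℤ), Q.toSet ⊆ (cell m t l k).toSet ∧
      (cell m t l k).dilate Γ ⊆ (cell m t (l + 1) (parentIndex m t k)).toSet := by
  have hs := Q.side_pos
  set L : ℝ := ((4 : ℝ) ^ m) ^ l with hL_def
  have hL : 0 < L := by positivity
  have hb : (0 : ℝ) < 4 ^ m := by positivity
  have hL1 : ((4 : ℝ) ^ m) ^ (l + 1) = 4 ^ m * L := by
    rw [zpow_add_one₀ hb.ne', mul_comm]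
  have hbL : 0 < 4 ^ m * L := by positivity
  choose t ht using fun i => exists_fin_three_ne ⌊3 * ((Q.corner i + Q.side) / L)⌋
    ⌊3 * ((Q.corner i + Q.side + (Γ + 1) * L) / (4 ^ m * L))⌋
  have near : ∀ (i : Fin n) (y : ℝ), Q.corner i ≤ y → y ≤ Q.corner i + Q.side →
      ⌊y / L - (t i : ℕ) / 3⌋ = ⌊Q.corner i / L - (t i : ℕ) / 3⌋ := by
    intro i y h1 h2
    refine floor_sub_third_eq ?_ (ht i).1 ⟨by gcongr, by gcongr⟩
    rw [← sub_div, div_lt_iff₀ hL]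
    linarith
  have far : ∀ (i : Fin n) (y : ℝ), Q.corner i - (Γ + 1) * L ≤ y →
      y ≤ Q.corner i + Q.side + (Γ + 1) * L →
      ⌊y / (4 ^ m * L) - (t i : ℕ) / 3⌋
        = ⌊(Q.corner i - (Γ + 1) * L) / (4 ^ m * L) - (t i : ℕ) / 3⌋ := by
    intro i y h1 h2
    refine floor_sub_third_eq ?_ (ht i).2 ⟨by gcongr, by gcongr⟩
    rw [← sub_div, div_lt_iff₀ hbL]
    nlinarith
  have hcorner : Q.corner ∈ (cell m t l (cellIndex m t l Q.corner)).toSet := mem_cell.2 rfl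
  refine ⟨t, cellIndex m t l Q.corner, fun x hx => mem_cell.2 ?_, fun x hx => mem_cell.2 ?_⟩
  · ext i
    exact near i (x i) (hx i).1 (hx i).2.le
  · rw [← cellIndex_succ]
    ext i
    have hx1 := (hx i).1
    have hx2 := (hx i).2
    have hc1 := (hcorner i).1
    have hc2 := (hcorner i).2
    have hside : (cell m t l (cellIndex m t l Q.corner)).side = L := rfl
    rw [hside] at hx1 hx2 hc2
    have hΓL : 0 < (Γ - 1) * L := mul_pos (by linarith) hL
    simp only [cellIndex, hL1]
    rw [far i (x i) (by linarith) (by linarith), far i (Q.corner i) (by nlinarith) (by nlinarith)]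

end Grid

section GridMaximal

variable {n m : ℕ} {σ ω : Measure (Fin n → ℝ)} {f : (Fin n → ℝ) → ℝ≥0∞}

/-- The maximal function over all the cells of the `3 ^ n` translated grids. -/
def gridMaximal (m : ℕ) (μ : Measure (Fin n → ℝ)) (x : Fin n → ℝ) : ℝ≥0∞ :=
  ⨆ (t : Fin n → Fin 3) (l : ℤ) (k : Fin n → ℤ), (cell m t l k).toSet.indicator
    (fun _ => μ (cell m t l k).toSet / volume (cell m t l k).toSet) x

lemma measurable_gridMaximal (μ : Measure (Fin n → ℝ)) : Measurable (gridMaximal m μ) :=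
  Measurable.iSup fun _ => Measurable.iSup fun _ => Measurable.iSup fun _ =>
    measurable_const.indicator (Cube.measurableSet_toSet _)

lemma le_gridMaximal (μ : Measure (Fin n → ℝ)) {t : Fin n → Fin 3} {l : ℤ} {k : Fin n → ℤ}
    {x : Fin n → ℝ} (hx : x ∈ (cell m t l k).toSet) :
    μ (cell m t l k).toSet / volume (cell m t l k).toSet ≤ gridMaximal m μ x :=
  le_iSup_of_le t (le_iSup_of_le l (le_iSup_of_le k (by rw [indicator_of_mem hx])))

lemma measure_div_volume_le (μ : Measure (Fin n → ℝ)) {Q R : Cube n} {c : ℝ≥0∞}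
    (hQR : Q.toSet ⊆ R.toSet) (hvol : volume R.toSet ≤ c * volume Q.toSet) :
    μ Q.toSet / volume Q.toSet ≤ c * (μ R.toSet / volume R.toSet) := by
  rw [ENNReal.div_le_iff Q.volume_ne_zero Q.volume_ne_top]
  calc μ Q.toSet ≤ μ R.toSet := measure_mono hQR
    _ = μ R.toSet / volume R.toSet * volume R.toSet :=
        (ENNReal.div_mul_cancel R.volume_ne_zero R.volume_ne_top).symm
    _ ≤ μ R.toSet / volume R.toSet * (c * volume Q.toSet) := by gcongr
    _ = _ := by ring

variable {Γ : ℝ}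

lemma maximal_le_gridMaximal (hΓ : 1 < Γ) (hm : 6 * Γ + 9 < 4 ^ m) (μ : Measure (Fin n → ℝ))
    (x : Fin n → ℝ) :
    maximal μ x ≤ ENNReal.ofReal (6 * 4 ^ m) ^ n * gridMaximal m μ x := by
  refine iSup_le fun Q => iSup₂_le fun _ hx => ?_
  have hs := Q.side_pos
  obtain ⟨j, hj1, hj2⟩ := exists_mem_Ioc_zpow (x := 6 * Q.side) (y := (4 : ℝ) ^ m)
    (by positivity) (by linarith)
  obtain ⟨t, k, hQ, -⟩ := exists_cell_dilate_subset hΓ hm Q hj2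
  refine (measure_div_volume_le μ hQ (c := ENNReal.ofReal (6 * 4 ^ m) ^ n) ?_).trans ?_
  · rw [Cube.volume_toSet, Cube.volume_toSet, ← mul_pow, ← ENNReal.ofReal_mul (by positivity)]
    refine pow_le_pow_left' (ENNReal.ofReal_le_ofReal ?_) n
    simp only [cell]
    rw [zpow_add_one₀ (by positivity)]
    have hb : (0 : ℝ) < 4 ^ m := by positivity
    nlinarith
  · gcongr
    exact le_gridMaximal μ (hQ hx)

/-- The `σ`-average of `f` at least doubles in passing from the parent to the cell `k`. -/
def IsJump (m : ℕ) (σ : Measure (Fin n → ℝ)) (f : (Fin n → ℝ) → ℝ≥0∞) (t : Fin n → Fin 3)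
    (l : ℤ) (k : Fin n → ℤ) : Prop :=
  2 * setAvg σ f (cell m t (l + 1) (parentIndex m t k)).toSet ≤ setAvg σ f (cell m t l k).toSet

/-- The maximal function over the cells that are doubling for `σ` or at which the averages of
`f` jump. -/
def selectedMaximal (m : ℕ) (D Γ : ℝ) (σ : Measure (Fin n → ℝ)) (f : (Fin n → ℝ) → ℝ≥0∞)
    (x : Fin n → ℝ) : ℝ≥0∞ :=
  ⨆ (t : Fin n → Fin 3) (l : ℤ) (k : Fin n → ℤ)
    (_ : σ ((cell m t l k).dilate Γ) ≤ ENNReal.ofReal D * σ (cell m t l k).toSet ∨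
      IsJump m σ f t l k),
    (cell m t l k).toSet.indicator
      (fun _ => σ.withDensity f (cell m t l k).toSet / volume (cell m t l k).toSet) x

lemma withDensity_cube [IsLocallyFiniteMeasure σ] (Q : Cube n) :
    σ.withDensity f Q.toSet = setAvg σ f Q.toSet * σ Q.toSet := by
  rw [withDensity_apply _ Q.measurableSet_toSet, setAvg_mul_measure (Q.measure_ne_top σ)]

/-- At a cell that is not selected, the average over the parent is much larger. -/
lemma mul_div_volume_le_parent [IsLocallyFiniteMeasure σ] {t : Fin n → Fin 3} {l : ℤ}
    {k : Fin n → ℤ}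
    (hsub : (cell m t l k).dilate Γ ⊆ (cell m t (l + 1) (parentIndex m t k)).toSet)
    (hdoub : ¬ σ ((cell m t l k).dilate Γ)
      ≤ ENNReal.ofReal (2 * ((4 ^ m) ^ n) ^ 2) * σ (cell m t l k).toSet)
    (hjump : ¬ IsJump m σ f t l k) :
    ENNReal.ofReal (4 ^ m) ^ n *
        (σ.withDensity f (cell m t l k).toSet / volume (cell m t l k).toSet)
      ≤ σ.withDensity f (cell m t (l + 1) (parentIndex m t k)).toSet /
        volume (cell m t (l + 1) (parentIndex m t k)).toSet := by
  set Q := cell m t l k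
  set P := cell m t (l + 1) (parentIndex m t k)
  have hvol : volume P.toSet = ENNReal.ofReal (4 ^ m) ^ n * volume Q.toSet := volume_cell_succ _ _
  set c := ENNReal.ofReal (4 ^ m) ^ n with hc
  have hD : ENNReal.ofReal (2 * ((4 ^ m) ^ n) ^ 2) = 2 * c ^ 2 := by
    rw [ENNReal.ofReal_mul (by norm_num), ENNReal.ofReal_pow (by positivity),
      ENNReal.ofReal_pow (by positivity)]
    norm_num [hc]
  rw [hD] at hdoub
  have h1 : 2 * c ^ 2 * σ Q.toSet ≤ σ P.toSet := (not_le.1 hdoub).le.trans (measure_mono hsub)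
  have h2 : setAvg σ f Q.toSet ≤ 2 * setAvg σ f P.toSet := (not_le.1 hjump).le
  have h3 : 2 * (c ^ 2 * σ.withDensity f Q.toSet) ≤ 2 * σ.withDensity f P.toSet := by
    rw [withDensity_cube, withDensity_cube]
    calc _ = setAvg σ f Q.toSet * (2 * c ^ 2 * σ Q.toSet) := by ring
      _ ≤ 2 * setAvg σ f P.toSet * σ P.toSet := by gcongr
      _ = _ := by ring
  have h4 := (ENNReal.mul_le_mul_iff_right (by norm_num) (by norm_num)).1 h3
  rw [ENNReal.le_div_iff_mul_le (Or.inl P.volume_ne_zero) (Or.inl P.volume_ne_top), hvol]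
  calc _ = c ^ 2 * (σ.withDensity f Q.toSet / volume Q.toSet * volume Q.toSet) := by ring
    _ ≤ _ := by rwa [ENNReal.div_mul_cancel Q.volume_ne_zero Q.volume_ne_top]

lemma gridMaximal_le_selectedMaximal [IsLocallyFiniteMeasure σ] (hn : 1 ≤ n) (hΓ : 1 < Γ)
    (hm : 6 * Γ + 9 < 4 ^ m) (hf : ∫⁻ x, f x ∂σ ≠ ⊤) (x : Fin n → ℝ) :
    gridMaximal m (σ.withDensity f) x
      ≤ ENNReal.ofReal (4 ^ m) ^ n * selectedMaximal m (2 * ((4 ^ m) ^ n) ^ 2) Γ σ f x := by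
  set c := ENNReal.ofReal (4 ^ m) ^ n with hc
  set S := selectedMaximal m (2 * ((4 ^ m) ^ n) ^ 2) Γ σ f x with hS
  set μ := σ.withDensity f with hμ
  have hc2 : 2 ≤ c := by
    have h2 : (2 : ℝ≥0∞) ≤ ENNReal.ofReal (4 ^ m) := by
      rw [show (2 : ℝ≥0∞) = ENNReal.ofReal 2 by norm_num]
      exact ENNReal.ofReal_le_ofReal (by linarith)
    exact h2.trans (le_self_pow (le_trans (by norm_num) h2) (by omega))
  have chain : ∀ (N : ℕ) (t : Fin n → Fin 3) (l : ℤ) (k : Fin n → ℤ),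
      x ∈ (cell m t l k).toSet → μ (cell m t l k).toSet / volume (cell m t l k).toSet
        ≤ max (c * S) ((2 : ℝ≥0∞)⁻¹ ^ N * (μ univ / volume (cell m t l k).toSet)) := by
    intro N
    induction N with
    | zero =>
      intro t l k _
      refine le_max_of_le_right ?_
      rw [pow_zero, one_mul]
      gcongr
      exact subset_univ _
    | succ N ih =>
      intro t l k hx
      set R := cell m t l k
      obtain ⟨t', k', hR, hdil⟩ := exists_cell_dilate_subset (l := l + 1) hΓ hm R (by
        change 6 * ((4 : ℝ) ^ m) ^ l ≤ _
        rw [zpow_add_one₀ (by positivity), mul_comm]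
        gcongr
        linarith)
      set Q := cell m t' (l + 1) k' with hQ
      set P := cell m t' (l + 1 + 1) (parentIndex m t' k') with hP
      have hvQ : volume Q.toSet = c * volume R.toSet := volume_cell_succ _ _
      have hvP : volume P.toSet = c * volume Q.toSet := volume_cell_succ _ _
      have hRQ : μ R.toSet / volume R.toSet ≤ c * (μ Q.toSet / volume Q.toSet) :=
        measure_div_volume_le μ hR hvQ.le
      have hxQ : x ∈ Q.toSet := hR hx
      by_cases hsel : σ (Q.dilate Γ) ≤ ENNReal.ofReal (2 * ((4 ^ m) ^ n) ^ 2) * σ Q.toSet ∨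
          IsJump m σ f t' (l + 1) k'
      · refine hRQ.trans (le_max_of_le_left ?_)
        gcongr
        refine le_iSup_of_le t' (le_iSup_of_le (l + 1) (le_iSup_of_le k' (le_iSup_of_le hsel ?_)))
        rw [indicator_of_mem hxQ]
      · push Not at hsel
        have hxP : x ∈ P.toSet := by
          rw [hP, mem_cell, cellIndex_succ, mem_cell.1 hxQ]
        have hQP := mul_div_volume_le_parent (f := f) hdil (not_le.2 hsel.1) hsel.2
        refine (hRQ.trans hQP).trans ((ih t' (l + 1 + 1) (parentIndex m t' k') hxP).trans ?_)
        refine max_le_max le_rfl ?_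
        have hv : 2 * volume R.toSet ≤ volume P.toSet := by
          rw [hvP, hvQ]
          calc 2 * volume R.toSet ≤ c * (1 * volume R.toSet) := by rw [one_mul]; gcongr
            _ ≤ _ := by gcongr; exact le_trans (by norm_num) hc2
        calc (2 : ℝ≥0∞)⁻¹ ^ N * (μ univ / volume P.toSet)
            ≤ (2 : ℝ≥0∞)⁻¹ ^ N * (μ univ / (2 * volume R.toSet)) := by gcongr
          _ = _ := by
            rw [div_eq_mul_inv, div_eq_mul_inv, ENNReal.mul_inv (by simp) (by simp), pow_succ]
            ring
  refine iSup_le fun t => iSup₂_le fun l k => ?_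
  by_cases hx : x ∈ (cell m t l k).toSet
  · rw [indicator_of_mem hx]
    have hfin : μ univ / volume (cell m t l k).toSet ≠ ⊤ :=
      ENNReal.div_ne_top (by rwa [hμ, withDensity_apply _ MeasurableSet.univ, setLIntegral_univ])
        (Cube.volume_ne_zero _)
    have lim : Tendsto (fun N : ℕ => max (c * S)
        ((2 : ℝ≥0∞)⁻¹ ^ N * (μ univ / volume (cell m t l k).toSet))) atTop
        (nhds (max (c * S) (0 * (μ univ / volume (cell m t l k).toSet)))) :=
      tendsto_const_nhds.max (ENNReal.Tendsto.mul_const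
        (ENNReal.tendsto_pow_atTop_nhds_zero_of_lt_one (by norm_num)) (Or.inr hfin))
    rw [zero_mul, max_eq_left (by simp)] at lim
    exact ge_of_tendsto' lim fun N => chain N t l k hx
  · simp [hx]

/-- The doubling cells are controlled by the restricted testing condition. -/
lemma lintegral_doubling_le [IsLocallyFiniteMeasure σ] [IsLocallyFiniteMeasure ω] {D : ℝ}
    {T : ℝ≥0∞} (hT : ∀ Q : Cube n, Q.memP → σ (Q.dilate Γ) ≤ ENNReal.ofReal D * σ Q.toSet →
      ∫⁻ x in Q.toSet, (maximal (σ.restrict Q.toSet) x) ^ 2 ∂ω ≤ T ^ 2 * σ Q.toSet)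
    (hf : Measurable f) (hf1 : ∫⁻ x, f x ∂σ ≠ ⊤) (t : Fin n → Fin 3) :
    ∫⁻ x, (⨆ q : {q : ℤ × (Fin n → ℤ) // σ ((cell m t q.1 q.2).dilate Γ)
        ≤ ENNReal.ofReal D * σ (cell m t q.1 q.2).toSet},
      (cell m t q.1.1 q.1.2).toSet.indicator (fun _ =>
        (σ.withDensity f (cell m t q.1.1 q.1.2).toSet /
          volume (cell m t q.1.1 q.1.2).toSet) ^ 2) x) ∂ω
      ≤ 16 * T ^ 2 * ∫⁻ x, f x ^ 2 ∂σ := by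
  set κ := {q : ℤ × (Fin n → ℤ) // σ ((cell m t q.1 q.2).dilate Γ)
        ≤ ENNReal.ofReal D * σ (cell m t q.1 q.2).toSet}
  have key := lintegral_iSup_setAvg_sq_le (κ := κ) (σ := σ) (ω := ω) (K := T ^ 2)
    (A := fun q => (cell m t q.1.1 q.1.2).toSet)
    (s := fun q => σ (cell m t q.1.1 q.1.2).toSet / volume (cell m t q.1.1 q.1.2).toSet)
    (fun q => Cube.measurableSet_toSet _) (fun q => Cube.measure_ne_top _ σ)
    (fun q r => cell_nested) (fun r => ?_) hf hf1
  · refine le_trans (le_of_eq ?_) key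
    refine lintegral_congr fun x => iSup_congr fun q => ?_
    rw [withDensity_cube, mul_comm, ENNReal.mul_div_right_comm]
  · refine le_trans (setLIntegral_mono' (Cube.measurableSet_toSet _) fun x _ => ?_)
      (hT _ memP_cell r.2)
    refine iSup₂_le fun q hq => ?_
    by_cases hx : x ∈ (cell m t q.1.1 q.1.2).toSet
    · rw [indicator_of_mem hx]
      gcongr
      refine le_iSup_of_le (cell m t q.1.1 q.1.2) (le_iSup₂_of_le memP_cell hx ?_)
      rw [Measure.restrict_apply (Cube.measurableSet_toSet _), inter_eq_left.2 hq]
    · simp [hx]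

/-- The cells at which the averages jump are controlled by `A2`. -/
lemma lintegral_jump_le [IsLocallyFiniteMeasure σ] (hf : Measurable f) (t : Fin n → Fin 3) :
    ∫⁻ x, (∑' (l : ℤ) (k : Fin n → ℤ), {k | IsJump m σ f t l k}.indicator (fun k =>
      (cell m t l k).toSet.indicator (fun _ =>
        (σ.withDensity f (cell m t l k).toSet / volume (cell m t l k).toSet) ^ 2) x) k) ∂ω
      ≤ 4 * A2 σ ω * ∫⁻ x, f x ^ 2 ∂σ := by
  have hmeas : ∀ l k, Measurable fun x => {k | IsJump m σ f t l k}.indicator (fun k =>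
      (cell m t l k).toSet.indicator (fun _ =>
        (σ.withDensity f (cell m t l k).toSet / volume (cell m t l k).toSet) ^ 2) x) k := by
    intro l k
    by_cases hk : IsJump m σ f t l k
    · simp only [indicator, mem_ofPred_eq, hk, if_true]
      exact measurable_const.indicator (Cube.measurableSet_toSet _)
    · simp [hk]
  have term : ∀ (Q : Cube n), Q.memP →
      (σ.withDensity f Q.toSet / volume Q.toSet) ^ 2 * ω Q.toSet
        ≤ A2 σ ω * (setAvg σ f Q.toSet ^ 2 * σ Q.toSet) := by
    intro Q hQ
    have : (σ Q.toSet / volume Q.toSet) * (ω Q.toSet / volume Q.toSet) ≤ A2 σ ω :=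
      le_iSup₂_of_le Q hQ le_rfl
    calc _ = (σ Q.toSet / volume Q.toSet) * (ω Q.toSet / volume Q.toSet) *
          (setAvg σ f Q.toSet ^ 2 * σ Q.toSet) := by
          rw [withDensity_cube]; simp only [div_eq_mul_inv]; ring
      _ ≤ _ := by gcongr
  have sq := tsum_lintegral_jump_sq_le (σ := σ) (p := cellIndex m t)
    (fun l => measurable_cellIndex)
    (fun l k => by rw [← cell_toSet_eq_preimage]; exact Cube.measure_ne_top _ σ)
    (parentIndex m t) (fun l x => cellIndex_succ x) hf (fun l => {k | IsJump m σ f t l k})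
    (fun l k hk => by simp only [← cell_toSet_eq_preimage]; exact hk)
  rw [lintegral_tsum fun l => (Measurable.tsum (hmeas l)).aemeasurable]
  calc _ ≤ ∑' l, A2 σ ω * ∫⁻ x, (cellIndex m t l ⁻¹' {k | IsJump m σ f t l k}).indicator
        (fun x => setAvg σ f (cellIndex m t l ⁻¹' {cellIndex m t l x}) ^ 2) x ∂σ := by
        refine ENNReal.tsum_le_tsum fun l => ?_
        have e := lintegral_comp_eq_tsum (measurable_cellIndex (m := m) (t := t) (l := l)) σ
          ({k | IsJump m σ f t l k}.indicator fun k => setAvg σ f (cell m t l k).toSet ^ 2)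
        rw [lintegral_tsum fun k => (hmeas l k).aemeasurable]
        simp only [← cell_toSet_eq_preimage] at e ⊢
        refine le_trans ?_ (mul_le_mul_right e.ge _)
        rw [← ENNReal.tsum_mul_left]
        refine ENNReal.tsum_le_tsum fun k => ?_
        by_cases hk : IsJump m σ f t l k
        · simp only [indicator_of_mem (show k ∈ {k | IsJump m σ f t l k} from hk)]
          rw [lintegral_indicator_const (Cube.measurableSet_toSet _)]
          exact term _ memP_cell
        · simp [hk]
    _ ≤ A2 σ ω * (4 * ∫⁻ x, f x ^ 2 ∂σ) := by
        rw [ENNReal.tsum_mul_left]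
        gcongr
    _ = _ := by ring

lemma le_rpow_half_iff {a b : ℝ≥0∞} : a ≤ b ^ ((1 : ℝ) / 2) ↔ a ^ 2 ≤ b := by
  rw [one_div, ENNReal.le_rpow_inv_iff (by norm_num), ENNReal.rpow_two]

lemma selectedMaximal_sq_le (D : ℝ) (x : Fin n → ℝ) :
    selectedMaximal m D Γ σ f x ^ 2 ≤ ∑ t : Fin n → Fin 3,
      ((⨆ q : {q : ℤ × (Fin n → ℤ) // σ ((cell m t q.1 q.2).dilate Γ)
          ≤ ENNReal.ofReal D * σ (cell m t q.1 q.2).toSet},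
        (cell m t q.1.1 q.1.2).toSet.indicator (fun _ =>
          (σ.withDensity f (cell m t q.1.1 q.1.2).toSet /
            volume (cell m t q.1.1 q.1.2).toSet) ^ 2) x) +
      ∑' (l : ℤ) (k : Fin n → ℤ), {k | IsJump m σ f t l k}.indicator (fun k =>
        (cell m t l k).toSet.indicator (fun _ =>
          (σ.withDensity f (cell m t l k).toSet / volume (cell m t l k).toSet) ^ 2) x) k) := by
  rw [← le_rpow_half_iff]
  refine iSup_le fun t => iSup₂_le fun l k => iSup_le fun h => ?_
  rw [le_rpow_half_iff]
  by_cases hx : x ∈ (cell m t l k).toSet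
  · refine le_trans ?_ (Finset.single_le_sum (fun _ _ => zero_le) (Finset.mem_univ t))
    rcases h with h | h
    · refine le_trans ?_ le_self_add
      refine le_iSup_of_le ⟨(l, k), h⟩ ?_
      simp [hx]
    · refine le_trans ?_ le_add_self
      refine le_trans ?_ (ENNReal.le_tsum l)
      refine le_trans ?_ (ENNReal.le_tsum k)
      simp [hx, h]
  · simp [hx]

lemma lintegral_gridMaximal_sq_le_of_lintegral_ne_top [IsLocallyFiniteMeasure σ]
    [IsLocallyFiniteMeasure ω] (hn : 1 ≤ n) (hΓ : 1 < Γ) (hm : 6 * Γ + 9 < 4 ^ m) {T : ℝ≥0∞}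
    (hT : ∀ Q : Cube n, Q.memP →
      σ (Q.dilate Γ) ≤ ENNReal.ofReal (2 * ((4 ^ m) ^ n) ^ 2) * σ Q.toSet →
      ∫⁻ x in Q.toSet, (maximal (σ.restrict Q.toSet) x) ^ 2 ∂ω ≤ T ^ 2 * σ Q.toSet)
    (hf : Measurable f) (hf1 : ∫⁻ x, f x ∂σ ≠ ⊤) :
    ∫⁻ x, gridMaximal m (σ.withDensity f) x ^ 2 ∂ω
      ≤ (ENNReal.ofReal (4 ^ m) ^ n) ^ 2 * (3 ^ n * (16 * T ^ 2 + 4 * A2 σ ω)) *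
        ∫⁻ x, f x ^ 2 ∂σ := by
  have hmeas : ∀ t : Fin n → Fin 3, Measurable fun x =>
      ⨆ q : {q : ℤ × (Fin n → ℤ) // σ ((cell m t q.1 q.2).dilate Γ)
        ≤ ENNReal.ofReal (2 * ((4 ^ m) ^ n) ^ 2) * σ (cell m t q.1 q.2).toSet},
      (cell m t q.1.1 q.1.2).toSet.indicator (fun _ =>
        (σ.withDensity f (cell m t q.1.1 q.1.2).toSet /
          volume (cell m t q.1.1 q.1.2).toSet) ^ 2) x := fun t =>
    Measurable.iSup fun q => measurable_const.indicator (Cube.measurableSet_toSet _)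
  have hmeas' : ∀ t : Fin n → Fin 3, Measurable fun x =>
      ∑' (l : ℤ) (k : Fin n → ℤ), {k | IsJump m σ f t l k}.indicator (fun k =>
        (cell m t l k).toSet.indicator (fun _ =>
          (σ.withDensity f (cell m t l k).toSet / volume (cell m t l k).toSet) ^ 2) x) k := by
    intro t
    refine Measurable.tsum fun l => Measurable.tsum fun k => ?_
    by_cases hk : IsJump m σ f t l k
    · simp only [indicator, mem_ofPred_eq, hk, if_true]
      exact measurable_const.indicator (Cube.measurableSet_toSet _)
    · simp [hk]
  set c := ENNReal.ofReal (4 ^ m) ^ n with hc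
  have hcfin : c ^ 2 ≠ ⊤ := ENNReal.pow_ne_top (ENNReal.pow_ne_top ENNReal.ofReal_ne_top)
  calc _ ≤ ∫⁻ x, c ^ 2 * selectedMaximal m (2 * ((4 ^ m) ^ n) ^ 2) Γ σ f x ^ 2 ∂ω := by
        refine lintegral_mono fun x => ?_
        rw [← mul_pow]
        gcongr
        exact gridMaximal_le_selectedMaximal hn hΓ hm hf1 x
    _ = c ^ 2 * ∫⁻ x, selectedMaximal m (2 * ((4 ^ m) ^ n) ^ 2) Γ σ f x ^ 2 ∂ω :=
        lintegral_const_mul' _ _ hcfin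
    _ ≤ c ^ 2 * ∑ t : Fin n → Fin 3,
        (16 * T ^ 2 * ∫⁻ x, f x ^ 2 ∂σ + 4 * A2 σ ω * ∫⁻ x, f x ^ 2 ∂σ) := by
        gcongr c ^ 2 * ?_
        refine (lintegral_mono fun x => selectedMaximal_sq_le _ x).trans ?_
        rw [lintegral_finsetSum _ fun t _ => (hmeas t).fun_add (hmeas' t)]
        refine Finset.sum_le_sum fun t _ => ?_
        rw [lintegral_add_left (hmeas t)]
        exact add_le_add (lintegral_doubling_le hT hf hf1 t) (lintegral_jump_le hf t)
    _ = _ := by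
        rw [Finset.sum_const, Finset.card_univ, Fintype.card_fun, Fintype.card_fin,
          Fintype.card_fin, nsmul_eq_mul]
        push_cast
        ring

lemma gridMaximal_mono {μ ν : Measure (Fin n → ℝ)} (h : μ ≤ ν) (x : Fin n → ℝ) :
    gridMaximal m μ x ≤ gridMaximal m ν x := by
  refine iSup_mono fun t => iSup₂_mono fun l k => indicator_le_indicator ?_
  gcongr

lemma lintegral_gridMaximal_sq_le [IsLocallyFiniteMeasure σ]
    [IsLocallyFiniteMeasure ω] (hn : 1 ≤ n) (hΓ : 1 < Γ) (hm : 6 * Γ + 9 < 4 ^ m) {T : ℝ≥0∞}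
    (hT : ∀ Q : Cube n, Q.memP →
      σ (Q.dilate Γ) ≤ ENNReal.ofReal (2 * ((4 ^ m) ^ n) ^ 2) * σ Q.toSet →
      ∫⁻ x in Q.toSet, (maximal (σ.restrict Q.toSet) x) ^ 2 ∂ω ≤ T ^ 2 * σ Q.toSet)
    (hf : Measurable f) :
    ∫⁻ x, gridMaximal m (σ.withDensity f) x ^ 2 ∂ω
      ≤ (ENNReal.ofReal (4 ^ m) ^ n) ^ 2 * (3 ^ n * (16 * T ^ 2 + 4 * A2 σ ω)) *
        ∫⁻ x, f x ^ 2 ∂σ := by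
  set g : ℕ → (Fin n → ℝ) → ℝ≥0∞ := fun j =>
    (Metric.closedBall 0 (j : ℝ)).indicator fun x => min (f x) j with hg
  have g_meas : ∀ j, Measurable (g j) := fun j =>
    (hf.min measurable_const).indicator Metric.isClosed_closedBall.measurableSet
  have g_le : ∀ j x, g j x ≤ f x := fun j x =>
    indicator_le' (fun _ _ => min_le_left _ _) (fun _ _ => zero_le) x
  have g_mono : Monotone g := by
    intro i j hij x
    have hij' : (i : ℝ) ≤ j := by exact_mod_cast hij
    by_cases hx : x ∈ Metric.closedBall (0 : Fin n → ℝ) (i : ℝ)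
    · have hx' := Metric.closedBall_subset_closedBall hij' hx
      simp only [hg, indicator_of_mem hx, indicator_of_mem hx']
      gcongr
    · simp [hg, indicator_of_notMem hx]
  have g_sup : ∀ x, ⨆ j, g j x = f x := by
    intro x
    refine le_antisymm (iSup_le fun j => g_le j x) (le_of_forall_lt fun y hy => ?_)
    obtain ⟨i, hi⟩ := ENNReal.exists_nat_gt hy.ne_top
    obtain ⟨j, hj⟩ := exists_nat_ge ‖x‖
    have hx : x ∈ Metric.closedBall (0 : Fin n → ℝ) ((max i j : ℕ) : ℝ) := by
      rw [mem_closedBall_zero_iff]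
      exact hj.trans (by exact_mod_cast le_max_right i j)
    refine lt_of_lt_of_le ?_ (le_iSup _ (max i j))
    simp only [hg, indicator_of_mem hx, lt_min_iff]
    exact ⟨hy, hi.trans_le (by exact_mod_cast le_max_left i j)⟩
  have g_int : ∀ j, ∫⁻ x, g j x ∂σ ≠ ⊤ := by
    intro j
    rw [hg, lintegral_indicator Metric.isClosed_closedBall.measurableSet]
    refine ne_top_of_le_ne_top ?_ (lintegral_mono fun x => min_le_right _ _)
    rw [setLIntegral_const]
    exact ENNReal.mul_ne_top (by simp) (isCompact_closedBall _ _).measure_lt_top.ne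
  have M_sup : ∀ x, gridMaximal m (σ.withDensity f) x ^ 2
      ≤ ⨆ j, gridMaximal m (σ.withDensity (g j)) x ^ 2 := by
    intro x
    rw [← le_rpow_half_iff]
    refine iSup_le fun t => iSup₂_le fun l k => ?_
    by_cases hx : x ∈ (cell m t l k).toSet
    · rw [indicator_of_mem hx, withDensity_apply _ (Cube.measurableSet_toSet _)]
      simp_rw [← g_sup]
      rw [lintegral_iSup g_meas g_mono, ENNReal.iSup_div]
      refine iSup_le fun j => ?_
      rw [le_rpow_half_iff, ← withDensity_apply _ (Cube.measurableSet_toSet _)]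
      refine le_trans ?_ (le_iSup _ j)
      gcongr
      exact le_gridMaximal _ hx
    · simp [hx]
  refine (lintegral_mono M_sup).trans ?_
  rw [lintegral_iSup (fun j => (measurable_gridMaximal _).pow_const 2)]
  · refine iSup_le fun j => ?_
    refine (lintegral_gridMaximal_sq_le_of_lintegral_ne_top hn hΓ hm hT (g_meas j)
      (g_int j)).trans ?_
    gcongr with x
    exact g_le j x
  · intro i j hij x
    refine pow_le_pow_left' (gridMaximal_mono ?_ x) 2
    exact withDensity_mono (Eventually.of_forall fun x => g_mono hij x)

end GridMaximal

/-- **A priori restricted testing bound.** For every `Γ' > 1` there exist `C > 0` and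
`D' > 1`, depending only on `Γ'` and the dimension `n`, such that for all locally finite
positive Borel measures `σ, ω` on `ℝⁿ` with finite full testing constant
`𝔗_M(σ,ω) < ∞`, one has `𝔑_M(σ,ω) ≤ C (𝔗_M^{D'}(Γ')(σ,ω) + √A₂(σ,ω))`. -/
theorem apriori_restricted_testing
    {n : ℕ} (hn : 1 ≤ n) (Γ' : ℝ) (hΓ' : 1 < Γ') :
    ∃ (C : ℝ≥0∞) (D' : ℝ), 0 < C ∧ C ≠ ⊤ ∧ 1 < D' ∧
      ∀ σ ω : Measure (Fin n → ℝ),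
        IsLocallyFiniteMeasure σ → IsLocallyFiniteMeasure ω →
        fullTesting σ ω ≠ ⊤ →
        opNorm σ ω ≤ C * (testD D' Γ' σ ω + A2 σ ω ^ ((1:ℝ)/2)) := by
  obtain ⟨m, hm⟩ := pow_unbounded_of_one_lt (6 * Γ' + 9) (show (1 : ℝ) < 4 by norm_num)
  have hb : (1 : ℝ) ≤ (4 ^ m) ^ n := one_le_pow₀ (by linarith)
  set c₁ : ℝ≥0∞ := ENNReal.ofReal (6 * 4 ^ m) ^ n with hc₁
  set c₂ : ℝ≥0∞ := ENNReal.ofReal (4 ^ m) ^ n with hc₂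
  have hc₁_top : c₁ ≠ ⊤ := ENNReal.pow_ne_top ENNReal.ofReal_ne_top
  have hc₂_top : c₂ ≠ ⊤ := ENNReal.pow_ne_top ENNReal.ofReal_ne_top
  have hc₁_pos : 0 < c₁ := ENNReal.pow_pos (ENNReal.ofReal_pos.2 (by positivity)) n
  have hc₂_pos : 0 < c₂ := ENNReal.pow_pos (ENNReal.ofReal_pos.2 (by positivity)) n
  set C : ℝ≥0∞ := 4 * c₁ * c₂ * 3 ^ n with hC
  have hC_pos : 0 < C := by
    refine pos_iff_ne_zero.2 ?_
    simp [hC, hc₁_pos.ne', hc₂_pos.ne']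
  have hC_top : C ≠ ⊤ := by
    refine ENNReal.mul_ne_top (ENNReal.mul_ne_top (ENNReal.mul_ne_top ?_ hc₁_top) hc₂_top) ?_
    · norm_num
    · exact ENNReal.pow_ne_top (by norm_num)
  refine ⟨C, 2 * ((4 ^ m) ^ n) ^ 2, hC_pos, hC_top, by nlinarith, ?_⟩
  intro σ ω hσ hω _
  suffices h : ∀ T : ℝ≥0∞, (∀ Q : Cube n, Q.memP →
      σ (Q.dilate Γ') ≤ ENNReal.ofReal (2 * ((4 ^ m) ^ n) ^ 2) * σ Q.toSet →
      ∫⁻ x in Q.toSet, (maximal (σ.restrict Q.toSet) x) ^ 2 ∂ω ≤ T ^ 2 * σ Q.toSet) →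
      opNorm σ ω ≤ C * (T + A2 σ ω ^ ((1 : ℝ) / 2)) by
    rw [mul_comm, ← ENNReal.div_le_iff hC_pos.ne' hC_top, ← tsub_le_iff_right]
    refine le_sInf fun T hT => ?_
    rw [tsub_le_iff_right, ENNReal.div_le_iff hC_pos.ne' hC_top, mul_comm]
    exact h T hT
  intro T hT
  refine sInf_le fun f hf => ?_
  calc ∫⁻ x, maximal (σ.withDensity f) x ^ 2 ∂ω
      ≤ ∫⁻ x, c₁ ^ 2 * gridMaximal m (σ.withDensity f) x ^ 2 ∂ω := by
        refine lintegral_mono fun x => ?_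
        rw [← mul_pow]
        exact pow_le_pow_left' (maximal_le_gridMaximal hΓ' hm _ x) 2
    _ = c₁ ^ 2 * ∫⁻ x, gridMaximal m (σ.withDensity f) x ^ 2 ∂ω :=
        lintegral_const_mul' _ _ (ENNReal.pow_ne_top hc₁_top)
    _ ≤ c₁ ^ 2 * (c₂ ^ 2 * (3 ^ n * (16 * T ^ 2 + 4 * A2 σ ω)) * ∫⁻ x, f x ^ 2 ∂σ) := by
        gcongr
        exact lintegral_gridMaximal_sq_le hn hΓ' hm hT hf
    _ ≤ c₁ ^ 2 * (c₂ ^ 2 * ((3 ^ n) ^ 2 * (16 * (T + A2 σ ω ^ ((1 : ℝ) / 2)) ^ 2)) *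
          ∫⁻ x, f x ^ 2 ∂σ) := by
        have h3 : (3 : ℝ≥0∞) ^ n ≤ (3 ^ n) ^ 2 :=
          le_self_pow (one_le_pow₀ (by norm_num)) two_ne_zero
        have hA : A2 σ ω = (A2 σ ω ^ ((1 : ℝ) / 2)) ^ 2 := by
          rw [← ENNReal.rpow_two, ← ENNReal.rpow_mul]; norm_num
        have hTA : 16 * T ^ 2 + 4 * A2 σ ω ≤ 16 * (T + A2 σ ω ^ ((1 : ℝ) / 2)) ^ 2 := by
          set a := A2 σ ω ^ ((1 : ℝ) / 2)
          rw [hA]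
          calc 16 * T ^ 2 + 4 * a ^ 2 ≤ 16 * T ^ 2 + 4 * a ^ 2 + (32 * (T * a) + 12 * a ^ 2) :=
                le_self_add
            _ = _ := by ring
        gcongr
    _ = _ := by rw [hC]; ring
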